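/- arXiv:2511.11544 — 2 statements merged into one kernel-verified Lean document; each statement's English description precedes it below -/
import Mathlib

section
/- The number of distinct solvabilizers in the alternating group A_5 is 32, i.e., |Solv(A_5)| = 32. -/
/-- The solvabilizer of an element `x` of a group `G`:
the set of `y ∈ G` such that `⟨x, y⟩` is solvable. -/
def solvabilizer {G : Type*} [Group G] (x : G) : Set G :=
  {y | IsSolvable ↥(Subgroup.closure {x, y})}

/-- `Solv(G)`, the set of distinct solvabilizers of elements of `G`. -/
def solvSet (G : Type*) [Group G] : Set (Set G) :=
  Set.range fun x : G => solvabilizer x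

namespace SolvA5

/-- If `K` is abelian, contains `y` and is normalized by `r`, then `⟨r, y⟩` is solvable. -/
theorem solv_of_normalizes {G : Type*} [Group G] (r y : G) (K : Subgroup G)
    (hK : ∀ a ∈ K, ∀ b ∈ K, a * b = b * a) (hy : y ∈ K) (hr : r ∈ Subgroup.normalizer (K : Set G)) :
    Group.IsSolvable ↥(Subgroup.closure {r, y}) := by
  set N := Subgroup.normalizer (K : Set G) with hN
  have hKN : K ≤ N := Subgroup.le_normalizer
  set r' : N := ⟨r, hr⟩
  set y' : N := ⟨y, hKN hy⟩
  have hmap : Subgroup.closure {r, y} = (Subgroup.closure {r', y'}).map N.subtype := by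
    rw [MonoidHom.map_closure]; simp [Set.image_pair, r', y']
  rw [hmap]
  suffices h : Group.IsSolvable ↥(Subgroup.closure {r', y'}) by
    exact Group.isSolvable_of_surjective
      (f := N.subtype.subgroupMap (Subgroup.closure {r', y'}))
      (N.subtype.subgroupMap_surjective _)
  let q : N →* N ⧸ (K.subgroupOf N) := QuotientGroup.mk' _
  have hyq : q y' = 1 := by
    simp only [q, QuotientGroup.mk'_apply, QuotientGroup.eq_one_iff]
    exact hy
  let H := Subgroup.closure {r', y'}
  let qH : H →* (Subgroup.zpowers (q r')) :=
    (q.comp H.subtype).codRestrict _ (by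
      rintro ⟨h, hh⟩
      have : H ≤ (Subgroup.zpowers (q r')).comap q := by
        rw [Subgroup.closure_le]
        rintro x (hx | hx)
        · rw [hx]; exact Subgroup.mem_zpowers _
        · have hx' : x = y' := hx
          rw [hx']
          change q y' ∈ Subgroup.zpowers (q r')
          rw [hyq]; exact one_mem _
      exact this hh)
  have : Group.IsSolvable ↥K := Group.isSolvable_of_comm (fun a b => Subtype.ext (hK a a.2 b b.2))
  have : Group.IsSolvable ↥(Subgroup.zpowers (q r')) := Group.isSolvable_of_comm (fun a b => by
    obtain ⟨_, i, rfl⟩ := a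
    obtain ⟨_, j, rfl⟩ := b
    exact Subtype.ext (zpow_mul_comm _ i j))
  let kK : qH.ker →* K :=
    ((N.subtype.comp H.subtype).comp qH.ker.subtype).codRestrict K (by
      rintro ⟨⟨h, hh⟩, hk⟩
      have h1 : q h = 1 := congrArg Subtype.val (MonoidHom.mem_ker.1 hk)
      simp only [q, QuotientGroup.mk'_apply, QuotientGroup.eq_one_iff] at h1
      exact h1)
  have hinj : Function.Injective kK := by
    intro a b hab
    have := congrArg Subtype.val hab
    exact Subtype.ext (Subtype.ext (Subtype.ext this))
  have : Group.IsSolvable qH.ker := Group.isSolvable_of_isSolvable_injective hinj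
  exact Group.isSolvable_of_ker_le_range qH.ker.subtype qH (by simp)

theorem solv_of_commute {G : Type*} [Group G] (r y : G) (h : r ^ 2 = 1 ∨ r ^ 3 = 1)
    (hc : y * (r * y * r⁻¹) = (r * y * r⁻¹) * y) :
    Group.IsSolvable ↥(Subgroup.closure {r, y}) := by
  set c : G ≃* G := MulAut.conj r with hcdef
  have c1 : c y = r * y * r⁻¹ := rfl
  have h01 : y * c y = c y * y := hc
  have h12 : c y * c (c y) = c (c y) * c y := by
    simpa using congrArg c h01
  have h02 : y * c (c y) = c (c y) * y ∧ (c (c (c y)) = y ∨ c (c (c y)) = c y) := by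
    rcases h with h | h
    · have : c (c y) = y := by
        have h2 : c (c y) = r ^ 2 * y * (r ^ 2)⁻¹ := by simp [c, pow_two, mul_assoc]
        rw [h2, h]; simp
      rw [this]; simp
    · have : c (c (c y)) = y := by
        have h2 : c (c (c y)) = r ^ 3 * y * (r ^ 3)⁻¹ := by simp [c, pow_succ, mul_assoc]
        rw [h2, h]; simp
      have h3 := congrArg c h12
      simp only [map_mul, this] at h3
      exact ⟨h3.symm, Or.inl this⟩
  set S : Set G := {y, c y, c (c y)} with hS
  have hcomm : ∀ a ∈ S, ∀ b ∈ S, a * b = b * a := by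
    rintro a (rfl | rfl | rfl) b (rfl | rfl | rfl) <;> simp [h01, h12, h02.1]
  have hle : ∀ a ∈ Subgroup.closure S, c a ∈ Subgroup.closure S := by
    intro a ha
    have : Subgroup.closure S ≤ (Subgroup.closure S).comap c.toMonoidHom := by
      rw [Subgroup.closure_le]
      rintro x (rfl | rfl | rfl)
      · exact Subgroup.subset_closure (by simp [S])
      · exact Subgroup.subset_closure (by simp [S])
      · change c (c (c y)) ∈ Subgroup.closure S
        rcases h02.2 with h | h <;> rw [h] <;> exact Subgroup.subset_closure (by simp [S])
    exact this ha
  refine solv_of_normalizes r y (Subgroup.closure S) ?_ (Subgroup.subset_closure (by simp [S])) ?_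
  · intro a ha b hb
    have := Subgroup.isMulCommutative_closure hcomm
    exact congrArg Subtype.val (this.1.comm (⟨a, ha⟩ : Subgroup.closure S) ⟨b, hb⟩)
  · have h6 : ∀ a, c (c (c (c (c (c a))))) = a := by
      intro a
      have h2 : c (c (c (c (c (c a))))) = r ^ 6 * a * (r ^ 6)⁻¹ := by
        simp [c, pow_succ, mul_assoc]
      have h6 : r ^ 6 = 1 := by
        rcases h with h | h
        · rw [show 6 = 2 * 3 from rfl, pow_mul, h, one_pow]
        · rw [show 6 = 3 * 2 from rfl, pow_mul, h, one_pow]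
      rw [h2, h6]; simp
    rw [Subgroup.mem_normalizer_iff]
    intro a
    refine ⟨hle a, fun ha => ?_⟩
    rw [← h6 a]
    exact hle _ (hle _ (hle _ (hle _ (hle _ ha))))

/-- A nontrivial triple of orders dividing `2`, `3`, `5` obstructs solvability. -/
theorem not_solv_of_triple {G : Type*} [Group G] (u v : G) (hu1 : u ≠ 1) (hu : u ^ 2 = 1)
    (hv : v ^ 3 = 1) (huv : (u * v) ^ 5 = 1) : ¬ Group.IsSolvable G := by
  rintro ⟨n, hn⟩
  have key : ∀ n, u ∈ derivedSeries G n ∧ v ∈ derivedSeries G n := by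
    intro n
    induction n with
    | zero => simp
    | succ n ih =>
      set D := derivedSeries G n
      let u' : D := ⟨u, ih.1⟩
      let v' : D := ⟨v, ih.2⟩
      have hu' : u' ^ 2 = 1 := Subtype.ext hu
      have hv' : v' ^ 3 = 1 := Subtype.ext hv
      have huv' : (u' * v') ^ 5 = 1 := Subtype.ext huv
      let A := Abelianization.of (G := D)
      have a1 : A u' ^ 2 = 1 := by rw [← map_pow, hu', map_one]
      have a2 : A v' ^ 3 = 1 := by rw [← map_pow, hv', map_one]
      have a3 : A u' ^ 5 * A v' ^ 5 = 1 := by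
        rw [← mul_pow, ← map_mul, ← map_pow, huv', map_one]
      have e1 : A u' ^ 5 = A u' := by
        rw [show 5 = 2 * 2 + 1 from rfl, pow_succ, pow_mul, a1]; simp
      have e2 : A v' ^ 5 = A v' ^ 2 := by
        rw [show 5 = 3 + 2 from rfl, pow_add, a2]; simp
      rw [e1, e2] at a3
      have a4 : A v' ^ 4 = 1 := by
        have := congrArg (· ^ 2) a3
        simp only [mul_pow, a1, one_mul, one_pow, ← pow_mul] at this
        exact this
      have av : A v' = 1 := by
        rw [pow_succ, a2, one_mul] at a4; exact a4
      have au : A u' = 1 := by simpa [av] using a3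
      have hmem : ∀ x : D, A x = 1 → (x : G) ∈ derivedSeries G (n + 1) := by
        intro x hx
        have hx' : x ∈ commutator D := by
          rw [← Abelianization.ker_of]; exact hx
        have : (x : G) ∈ (commutator D).map D.subtype := ⟨x, hx', rfl⟩
        rw [commutator_def, Subgroup.map_commutator] at this
        simpa [← MonoidHom.range_eq_map, derivedSeries_succ] using this
      exact ⟨hmem u' au, hmem v' av⟩
  have := (key n).1
  rw [hn] at this
  exact hu1 (Subgroup.mem_bot.1 this)

theorem not_solv_closure {G : Type*} [Group G] {H : Subgroup G} (u v : G) (huH : u ∈ H)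
    (hvH : v ∈ H) (hu1 : u ≠ 1) (hu : u ^ 2 = 1)
    (hv : v ^ 3 = 1) (huv : (u * v) ^ 5 = 1) : ¬ Group.IsSolvable H :=
  not_solv_of_triple (⟨u, huH⟩ : H) ⟨v, hvH⟩ (fun h => hu1 (congrArg Subtype.val h))
    (Subtype.ext hu) (Subtype.ext hv) (Subtype.ext huv)

/-- `⟨u, v⟩` is visibly a quotient of the `(2, 3, 5)` triangle group. -/
def Tri {G : Type*} [Mul G] [One G] (u v : G) : Prop :=
  u * u = 1 ∧ u ≠ 1 ∧ v * v * v = 1 ∧ u * v * (u * v) * (u * v) * (u * v) * (u * v) = 1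

/-- One of six pairs of words in `s` and `y` is a `(2, 3, 5)` pair. -/
def Bad {G : Type*} [Mul G] [One G] (s y : G) : Prop :=
  Tri s y ∨ Tri y (y * s) ∨ Tri (y * s) s ∨ Tri (y * s * y) s ∨ Tri (s * s * y) s ∨
    Tri (s * s * y * s) (s * y * y)

/-- `r` has order dividing `2` or `3`, and `y` commutes with its conjugate by `r`. -/
def Good₁ {G : Type*} [Mul G] [One G] (r y : G) : Prop :=
  (r * r = 1 ∧ y * (r * y * r) = (r * y * r) * y) ∨
  (r * r * r = 1 ∧ y * (r * y * (r * r)) = (r * y * (r * r)) * y)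

def Good {G : Type*} [Mul G] [One G] (r y : G) : Prop := Good₁ r y ∨ Good₁ y r

/-- `x` and `r` are powers of each other. -/
def Same {G : Type*} [Mul G] (x r : G) : Prop :=
  x = r ∨ (x = r * r ∧ r = x * x) ∨ (x = r * r ∧ r = x * x * x) ∨
    (x = r * r * r ∧ r = x * x) ∨ (x = r * r * r * r ∧ r = x * x * x * x)

instance decTri {G : Type*} [Mul G] [One G] [DecidableEq G] (u v : G) : Decidable (Tri u v) := by
  unfold Tri; infer_instance

instance decBad {G : Type*} [Mul G] [One G] [DecidableEq G] (u v : G) : Decidable (Bad u v) := by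
  unfold Bad; infer_instance

instance decGood {G : Type*} [Mul G] [One G] [DecidableEq G] (u v : G) : Decidable (Good u v) := by
  unfold Good Good₁; infer_instance

instance decSame {G : Type*} [Mul G] [DecidableEq G] (u v : G) : Decidable (Same u v) := by
  unfold Same; infer_instance

section transfer

variable {G M : Type*} [Mul G] [One G] [Mul M] [One M] (f : G → M)

theorem tri_iff (hf : Function.Injective f) (h1 : f 1 = 1) (hm : ∀ a b, f (a * b) = f a * f b)
    (u v : G) : Tri (f u) (f v) ↔ Tri u v := by
  simp only [Tri, ← hm, ← h1, hf.eq_iff, ne_eq]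

theorem bad_iff (hf : Function.Injective f) (h1 : f 1 = 1) (hm : ∀ a b, f (a * b) = f a * f b)
    (u v : G) : Bad (f u) (f v) ↔ Bad u v := by
  simp only [Bad, ← hm, tri_iff f hf h1 hm]

theorem good_iff (hf : Function.Injective f) (h1 : f 1 = 1) (hm : ∀ a b, f (a * b) = f a * f b)
    (u v : G) : Good (f u) (f v) ↔ Good u v := by
  simp only [Good, Good₁, ← hm, ← h1, hf.eq_iff]

theorem same_iff (hf : Function.Injective f) (hm : ∀ a b, f (a * b) = f a * f b)
    (u v : G) : Same (f u) (f v) ↔ Same u v := by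
  simp only [Same, ← hm, hf.eq_iff]

end transfer

theorem good₁_solv {G : Type*} [Group G] {r y : G} (h : Good₁ r y) :
    Group.IsSolvable ↥(Subgroup.closure {r, y}) := by
  rcases h with ⟨h1, h2⟩ | ⟨h1, h2⟩
  · refine solv_of_commute r y (Or.inl (by rw [pow_two]; exact h1)) ?_
    rw [inv_eq_of_mul_eq_one_left h1]; exact h2
  · refine solv_of_commute r y (Or.inr (by rw [pow_succ, pow_two]; exact h1)) ?_
    rw [inv_eq_of_mul_eq_one_left h1]; exact h2

theorem good_mem {G : Type*} [Group G] {r y : G} (h : Good r y) : y ∈ solvabilizer r := by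
  rcases h with h | h
  · exact good₁_solv h
  · have := good₁_solv h
    rw [Set.pair_comm] at this
    exact this

theorem bad_not_mem {G : Type*} [Group G] {s y : G} (h : Bad s y) : y ∉ solvabilizer s := by
  have hs : s ∈ Subgroup.closure {s, y} := Subgroup.subset_closure (by simp)
  have hy : y ∈ Subgroup.closure {s, y} := Subgroup.subset_closure (by simp)
  have key : ∀ u v : G, u ∈ Subgroup.closure {s, y} → v ∈ Subgroup.closure {s, y} → Tri u v →
      y ∉ solvabilizer s := fun u v hu hv h =>
    not_solv_closure u v hu hv h.2.1 (by rw [pow_two]; exact h.1)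
      (by rw [pow_succ, pow_two]; exact h.2.2.1)
      (by rw [pow_succ, pow_succ, pow_succ, pow_two]; exact h.2.2.2)
  rcases h with h | h | h | h | h | h
  all_goals
    refine key _ _ ?_ ?_ h
    all_goals (repeat' apply mul_mem) <;> assumption

theorem solvabilizer_eq_of_pow {G : Type*} [Group G] {x r : G} (j k : ℕ) (h1 : x = r ^ j)
    (h2 : r = x ^ k) : solvabilizer x = solvabilizer r := by
  ext y
  have : Subgroup.closure {x, y} = Subgroup.closure {r, y} := by
    apply le_antisymm <;> rw [Subgroup.closure_le] <;> rintro z (rfl | rfl)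
    · rw [h1]; exact pow_mem (Subgroup.subset_closure (by simp)) _
    · exact Subgroup.subset_closure (by simp)
    · rw [h2]; exact pow_mem (Subgroup.subset_closure (by simp)) _
    · exact Subgroup.subset_closure (by simp)
  change Group.IsSolvable _ ↔ Group.IsSolvable _
  rw [this]

/-- An even permutation given by its table and the table of its inverse. -/
abbrev mk (f g : Fin 5 → Fin 5) (h₁ : ∀ i, g (f i) = i) (h₂ : ∀ i, f (g i) = i)
    (h : Equiv.Perm.sign (⟨f, g, h₁, h₂⟩ : Equiv.Perm (Fin 5)) = 1) : alternatingGroup (Fin 5) :=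
  ⟨⟨f, g, h₁, h₂⟩, Equiv.Perm.mem_alternatingGroup.2 h⟩

/-- One generator for each cyclic subgroup of `A₅`. -/
def rep : Fin 32 → alternatingGroup (Fin 5) := ![
  mk ![0, 1, 2, 3, 4] ![0, 1, 2, 3, 4] (by decide) (by decide) (by decide),
  mk ![0, 1, 3, 4, 2] ![0, 1, 4, 2, 3] (by decide) (by decide) (by decide),
  mk ![0, 2, 1, 4, 3] ![0, 2, 1, 4, 3] (by decide) (by decide) (by decide),
  mk ![0, 2, 3, 1, 4] ![0, 3, 1, 2, 4] (by decide) (by decide) (by decide),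
  mk ![0, 2, 4, 3, 1] ![0, 4, 1, 3, 2] (by decide) (by decide) (by decide),
  mk ![0, 3, 2, 4, 1] ![0, 4, 2, 1, 3] (by decide) (by decide) (by decide),
  mk ![0, 3, 4, 1, 2] ![0, 3, 4, 1, 2] (by decide) (by decide) (by decide),
  mk ![0, 4, 3, 2, 1] ![0, 4, 3, 2, 1] (by decide) (by decide) (by decide),
  mk ![1, 0, 2, 4, 3] ![1, 0, 2, 4, 3] (by decide) (by decide) (by decide),
  mk ![1, 0, 3, 2, 4] ![1, 0, 3, 2, 4] (by decide) (by decide) (by decide),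
  mk ![1, 0, 4, 3, 2] ![1, 0, 4, 3, 2] (by decide) (by decide) (by decide),
  mk ![1, 2, 0, 3, 4] ![2, 0, 1, 3, 4] (by decide) (by decide) (by decide),
  mk ![1, 2, 3, 4, 0] ![4, 0, 1, 2, 3] (by decide) (by decide) (by decide),
  mk ![1, 2, 4, 0, 3] ![3, 0, 1, 4, 2] (by decide) (by decide) (by decide),
  mk ![1, 3, 0, 4, 2] ![2, 0, 4, 1, 3] (by decide) (by decide) (by decide),
  mk ![1, 3, 2, 0, 4] ![3, 0, 2, 1, 4] (by decide) (by decide) (by decide),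
  mk ![1, 3, 4, 2, 0] ![4, 0, 3, 1, 2] (by decide) (by decide) (by decide),
  mk ![1, 4, 0, 2, 3] ![2, 0, 3, 4, 1] (by decide) (by decide) (by decide),
  mk ![1, 4, 2, 3, 0] ![4, 0, 2, 3, 1] (by decide) (by decide) (by decide),
  mk ![1, 4, 3, 0, 2] ![3, 0, 4, 2, 1] (by decide) (by decide) (by decide),
  mk ![2, 1, 0, 4, 3] ![2, 1, 0, 4, 3] (by decide) (by decide) (by decide),
  mk ![2, 1, 3, 0, 4] ![3, 1, 0, 2, 4] (by decide) (by decide) (by decide),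
  mk ![2, 1, 4, 3, 0] ![4, 1, 0, 3, 2] (by decide) (by decide) (by decide),
  mk ![2, 3, 0, 1, 4] ![2, 3, 0, 1, 4] (by decide) (by decide) (by decide),
  mk ![2, 4, 0, 3, 1] ![2, 4, 0, 3, 1] (by decide) (by decide) (by decide),
  mk ![3, 1, 2, 4, 0] ![4, 1, 2, 0, 3] (by decide) (by decide) (by decide),
  mk ![3, 1, 4, 0, 2] ![3, 1, 4, 0, 2] (by decide) (by decide) (by decide),
  mk ![3, 2, 1, 0, 4] ![3, 2, 1, 0, 4] (by decide) (by decide) (by decide),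
  mk ![3, 4, 2, 0, 1] ![3, 4, 2, 0, 1] (by decide) (by decide) (by decide),
  mk ![4, 1, 3, 2, 0] ![4, 1, 3, 2, 0] (by decide) (by decide) (by decide),
  mk ![4, 2, 1, 3, 0] ![4, 2, 1, 3, 0] (by decide) (by decide) (by decide),
  mk ![4, 3, 2, 1, 0] ![4, 3, 2, 1, 0] (by decide) (by decide) (by decide)]

/-- Self-maps of `{0, …, 4}`, packed as base-`8` numerals. -/
structure Code where
  /-- the numeral -/
  n : ℕ

theorem Code.eq_iff (a b : Code) : a.n = b.n ↔ a = b :=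
  ⟨fun h => by cases a; cases b; simpa using h, fun h => h ▸ rfl⟩

instance : DecidableEq Code := fun a b => decidable_of_iff (a.n = b.n) (Code.eq_iff a b)

/-- The `i`-th digit. -/
def Code.app (c : Code) (i : ℕ) : ℕ := c.n / 8 ^ i % 8

instance : Mul Code := ⟨fun a b => ⟨a.app (b.app 0) + 8 * a.app (b.app 1) + 64 * a.app (b.app 2) +
  512 * a.app (b.app 3) + 4096 * a.app (b.app 4)⟩⟩

instance : One Code := ⟨⟨18056⟩⟩

/-- The code of an element of `A₅`. -/
def code (x : alternatingGroup (Fin 5)) : Code :=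
  ⟨(x.1 0).1 + 8 * (x.1 1).1 + 64 * (x.1 2).1 + 512 * (x.1 3).1 + 4096 * (x.1 4).1⟩

theorem code_app (x : alternatingGroup (Fin 5)) (i : Fin 5) : (code x).app i.1 = (x.1 i).1 := by
  have h0 := (x.1 0).2
  have h1 := (x.1 1).2
  have h2 := (x.1 2).2
  have h3 := (x.1 3).2
  have h4 := (x.1 4).2
  fin_cases i <;> simp [code, Code.app] <;> omega

theorem code_injective : Function.Injective code := by
  intro x y h
  apply Subtype.ext
  ext i
  rw [← code_app, ← code_app, h]

theorem code_one : code 1 = 1 := rfl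

theorem code_mul (x y : alternatingGroup (Fin 5)) : code (x * y) = code x * code y := by
  have h (i : Fin 5) : (code x).app ((code y).app i.1) = ((x * y).1 i).1 := by
    rw [code_app, code_app]; rfl
  have h0 := h 0
  have h1 := h 1
  have h2 := h 2
  have h3 := h 3
  have h4 := h 4
  change Code.mk _ = Code.mk _
  rw [← h0, ← h1, ← h2, ← h3, ← h4]
  rfl

/-- The codes of the representatives. -/
def repCodes : List ℕ := [
  18056, 10440, 14416, 17104, 5904, 6296, 8984, 5344, 14465, 17601, 9985, 17937, 2257,
  12561, 10265, 16537, 1305, 13345, 1697, 8417, 14346, 16586, 1802, 16922, 5666, 2187,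
  8459, 16467, 4259, 1228, 1620, 668]

/-- The codes of all elements of `A₅`. -/
def allCodes : List ℕ := [
  18056, 10440, 13576, 14416, 17104, 5904, 17496, 6296, 8984, 9824, 12960, 5344, 14465,
  17601, 9985, 17937, 2257, 12561, 10265, 16537, 1305, 13345, 1697, 8417, 17986, 6338,
  13058, 14346, 16586, 1802, 16922, 2138, 4378, 5666, 12386, 738, 10307, 17027, 5379,
  17419, 2187, 8459, 6163, 16467, 787, 8739, 1123, 4259, 13380, 5764, 8900, 9740, 12428,
  1228, 12820, 1620, 4308, 5148, 8284, 668]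

/-- The code of the `i`-th representative. -/
def repCode (i : Fin 32) : Code := ⟨repCodes.getD i.1 0⟩

theorem code_rep : ∀ i : Fin 32, code (rep i) = repCode i := by
  decide +kernel

theorem code_sep : ∀ i j : Fin 32, i < j → ∃ k : Fin 32,
    (Good (repCode i) (repCode k) ∧ Bad (repCode j) (repCode k)) ∨
    (Good (repCode j) (repCode k) ∧ Bad (repCode i) (repCode k)) := by
  decide +kernel

theorem code_mem : ∀ x : alternatingGroup (Fin 5), (code x).n ∈ allCodes := by
  decide +kernel

theorem code_cover : ∀ c ∈ allCodes, ∃ i : Fin 32, Same (Code.mk c) (repCode i) := by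
  decide +kernel

theorem rep_sep (i j : Fin 32) (hij : i < j) : ∃ k : Fin 32,
    (Good (rep i) (rep k) ∧ Bad (rep j) (rep k)) ∨
    (Good (rep j) (rep k) ∧ Bad (rep i) (rep k)) := by
  have h := code_sep i j hij
  simpa only [← code_rep, bad_iff code code_injective code_one code_mul,
    good_iff code code_injective code_one code_mul] using h

theorem rep_cover (x : alternatingGroup (Fin 5)) : ∃ i : Fin 32, Same x (rep i) := by
  obtain ⟨i, h⟩ := code_cover _ (code_mem x)
  rw [← code_rep] at h
  exact ⟨i, (same_iff code code_injective code_mul _ _).1 h⟩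

theorem rep_injective : Function.Injective fun i => solvabilizer (rep i) := by
  have key : ∀ i j : Fin 32, i < j → solvabilizer (rep i) ≠ solvabilizer (rep j) := by
    intro i j hij h
    obtain ⟨k, ⟨h1, h2⟩ | ⟨h1, h2⟩⟩ := rep_sep i j hij
    · exact bad_not_mem h2 (h ▸ good_mem h1)
    · exact bad_not_mem h2 (h ▸ good_mem h1)
  intro i j h
  rcases lt_trichotomy i j with hij | hij | hij
  · exact absurd h (key i j hij)
  · exact hij
  · exact absurd h.symm (key j i hij)

theorem solvSet_eq : solvSet (alternatingGroup (Fin 5)) =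
    Set.range fun i => solvabilizer (rep i) := by
  apply Set.Subset.antisymm
  · rintro _ ⟨x, rfl⟩
    obtain ⟨i, h⟩ := rep_cover x
    refine ⟨i, ?_⟩
    rcases h with h | h | h | h | h
    · rw [h]
    · exact (solvabilizer_eq_of_pow 2 2 (by simpa only [pow_succ, pow_zero, one_mul] using h.1)
        (by simpa only [pow_succ, pow_zero, one_mul] using h.2)).symm
    · exact (solvabilizer_eq_of_pow 2 3 (by simpa only [pow_succ, pow_zero, one_mul] using h.1)
        (by simpa only [pow_succ, pow_zero, one_mul] using h.2)).symm
    · exact (solvabilizer_eq_of_pow 3 2 (by simpa only [pow_succ, pow_zero, one_mul] using h.1)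
        (by simpa only [pow_succ, pow_zero, one_mul] using h.2)).symm
    · exact (solvabilizer_eq_of_pow 4 4 (by simpa only [pow_succ, pow_zero, one_mul] using h.1)
        (by simpa only [pow_succ, pow_zero, one_mul] using h.2)).symm
  · rintro _ ⟨i, rfl⟩
    exact ⟨rep i, rfl⟩

end SolvA5

/-- The number of distinct solvabilizers in the alternating group `A₅` is `32`. -/
theorem solvSet_ncard_alternatingGroup_five :
    (solvSet (alternatingGroup (Fin 5))).ncard = 32 := by
  rw [SolvA5.solvSet_eq, ← Set.image_univ, Set.ncard_image_of_injective _ SolvA5.rep_injective]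
  simp
end

section
/- For every integer n ≥ 2, the projective special linear group G = PSL(2, 2^n) satisfies |Solv(G)| = 2·(2^n)^2 = 2^(2n+1). -/
/-- The projective special linear group `PSL(n, R)`. -/
noncomputable abbrev PSL (n : ℕ) (R : Type*) [CommRing R] : Type _ :=
  Matrix.SpecialLinearGroup (Fin n) R ⧸
    Subgroup.center (Matrix.SpecialLinearGroup (Fin n) R)

section Aux
open Group
open scoped commutatorElement

theorem solvabilizer_mulEquiv {G H : Type*} [Group G] [Group H] (e : G ≃* H) (x : G) :
    solvabilizer (e x) = e '' solvabilizer x := by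
  have key : ∀ y, Group.IsSolvable ↥(Subgroup.closure {e x, e y}) ↔
      Group.IsSolvable ↥(Subgroup.closure {x, y}) := by
    intro y
    have h : Subgroup.closure {e x, e y} = (Subgroup.closure {x, y}).map e.toMonoidHom := by
      rw [MonoidHom.map_closure]
      congr 1
      simp [Set.image_pair]
    let f := (Subgroup.closure {x, y}).equivMapOfInjective e.toMonoidHom e.injective
    rw [h]
    constructor
    · intro _
      exact Group.isSolvable_of_isSolvable_injective (f := f.toMonoidHom) f.injective
    · intro _
      exact Group.isSolvable_of_isSolvable_injective (f := f.symm.toMonoidHom) f.symm.injective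
  ext z
  constructor
  · intro hz
    refine ⟨e.symm z, ?_, by simp⟩
    have := (key (e.symm z)).1
    rw [e.apply_symm_apply] at this
    exact this hz
  · rintro ⟨y, hy, rfl⟩
    exact (key y).2 hy

theorem solvSet_ncard_congr {G H : Type*} [Group G] [Group H] (e : G ≃* H) :
    (solvSet G).ncard = (solvSet H).ncard := by
  have h : solvSet H = (fun s : Set G => e '' s) '' solvSet G := by
    ext s
    constructor
    · rintro ⟨y, rfl⟩
      refine ⟨solvabilizer (e.symm y), ⟨_, rfl⟩, ?_⟩
      simp [← solvabilizer_mulEquiv]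
    · rintro ⟨_, ⟨x, rfl⟩, rfl⟩
      exact ⟨e x, solvabilizer_mulEquiv e x⟩
  rw [h, Set.ncard_image_of_injective _ e.injective.image_injective]

theorem solvable_of_commutator_mem {G : Type*} [Group G] (H A : Subgroup G)
    (hA : ∀ a ∈ A, ∀ b ∈ A, a * b = b * a)
    (hH : ∀ h ∈ H, ∀ k ∈ H, ⁅h, k⁆ ∈ A) : Group.IsSolvable H := by
  have h1 : derivedSeries H 1 ≤ A.comap H.subtype := by
    rw [derivedSeries_succ, Subgroup.commutator_le]
    intro a _ b _
    exact hH a a.2 b b.2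
  refine ⟨⟨2, ?_⟩⟩
  rw [eq_bot_iff, derivedSeries_succ, Subgroup.commutator_le]
  intro a ha b hb
  have ha' := h1 ha
  have hb' := h1 hb
  rw [Subgroup.mem_bot, commutatorElement_eq_one_iff_mul_comm]
  exact Subtype.ext (hA _ ha' _ hb')

theorem exists_abelian_normal {H : Type*} [Group H] [Group.IsSolvable H] [Nontrivial H] :
    ∃ a : H, a ≠ 1 ∧ ∀ h : H, (h * a * h⁻¹) * a = a * (h * a * h⁻¹) := by
  classical
  have hex : ∃ n, derivedSeries H n = ⊥ := (inferInstance : Group.IsSolvable H).solvable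
  have hs := Nat.find_spec hex
  have hm := fun m => @Nat.find_min _ _ hex m
  rcases hn : Nat.find hex with _ | n
  · rw [hn, derivedSeries_zero] at hs
    exact absurd hs top_ne_bot
  · rw [hn] at hs
    have hne := hm n (by omega)
    obtain ⟨a, ha, ha1⟩ := Subgroup.ne_bot_iff_exists_ne_one.1 hne |>.elim
      fun a h => (⟨a.1, a.2, fun h' => h (Subtype.ext h')⟩ :
        ∃ a, a ∈ derivedSeries H n ∧ a ≠ 1)
    refine ⟨a, ha1, fun h => ?_⟩
    have h2 : h * a * h⁻¹ ∈ derivedSeries H n := (derivedSeries_normal H n).conj_mem a ha h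
    rw [derivedSeries_succ] at hs
    have := Subgroup.commutator_mem_commutator h2 ha
    rw [hs, Subgroup.mem_bot, commutatorElement_eq_one_iff_mul_comm] at this
    exact this

end Aux

section MatAux
open Matrix
open scoped commutatorElement

variable {F : Type*} [Field F]

/-- The underlying matrix. -/
def matOf (x : SpecialLinearGroup (Fin 2) F) : Matrix (Fin 2) (Fin 2) F := x

theorem matOf_mul (x y : SpecialLinearGroup (Fin 2) F) : matOf (x * y) = matOf x * matOf y :=
  Matrix.SpecialLinearGroup.coe_mul x y

@[simp] theorem matOf_one : matOf (1 : SpecialLinearGroup (Fin 2) F) = 1 := rfl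

@[simp] theorem matOf_det (x : SpecialLinearGroup (Fin 2) F) : (matOf x).det = 1 := x.2

theorem matOf_inj {x y : SpecialLinearGroup (Fin 2) F} (h : matOf x = matOf y) : x = y := Subtype.ext h

/-- A non-scalar `2 × 2` matrix. -/
def NotScalarMat (M : Matrix (Fin 2) (Fin 2) F) : Prop :=
  M 0 1 ≠ 0 ∨ M 1 0 ≠ 0 ∨ M 0 0 ≠ M 1 1

theorem comm_form {M B : Matrix (Fin 2) (Fin 2) F} (hM : NotScalarMat M) (h : M * B = B * M) :
    ∃ p q : F, B = p • (1 : Matrix (Fin 2) (Fin 2) F) + q • M := by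
  have h00 := congrFun (congrFun h 0) 0
  have h01 := congrFun (congrFun h 0) 1
  have h10 := congrFun (congrFun h 1) 0
  simp only [Matrix.mul_apply, Fin.sum_univ_two] at h00 h01 h10
  rcases hM with h' | h' | h'
  · refine ⟨B 0 0 - B 0 1 / M 0 1 * M 0 0, B 0 1 / M 0 1, ?_⟩
    ext i j
    fin_cases i <;> fin_cases j <;> simp <;> field_simp
    · linear_combination h00
    · linear_combination h01
  · refine ⟨B 0 0 - B 1 0 / M 1 0 * M 0 0, B 1 0 / M 1 0, ?_⟩
    ext i j
    fin_cases i <;> fin_cases j <;> simp <;> field_simp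
    · linear_combination -h00
    · linear_combination -h10
  · have h'' : M 0 0 - M 1 1 ≠ 0 := sub_ne_zero.2 h'
    refine ⟨B 0 0 - (B 0 0 - B 1 1) / (M 0 0 - M 1 1) * M 0 0,
      (B 0 0 - B 1 1) / (M 0 0 - M 1 1), ?_⟩
    ext i j
    fin_cases i <;> fin_cases j <;> simp <;> field_simp
    · linear_combination h01
    · linear_combination -h10
    · ring

theorem comm_comm {M A B : Matrix (Fin 2) (Fin 2) F} (hM : NotScalarMat M) (hA : M * A = A * M)
    (hB : M * B = B * M) : A * B = B * A := by
  obtain ⟨p, q, rfl⟩ := comm_form hM hA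
  simp [add_mul, mul_add, hB]

theorem conj_tr_det {h : SpecialLinearGroup (Fin 2) F} {M B : Matrix (Fin 2) (Fin 2) F}
    (hh : matOf h * M = B * matOf h) : B.trace = M.trace ∧ B.det = M.det := by
  have hB : B = matOf h * M * matOf h⁻¹ := by
    rw [hh, mul_assoc, ← matOf_mul]; simp
  constructor
  · rw [hB, Matrix.trace_mul_comm, ← mul_assoc, ← matOf_mul]; simp
  · have := congrArg Matrix.det hh
    simpa using this.symm

/-- `h` normalises the algebra generated by `M`. -/
def Nrm (M : Matrix (Fin 2) (Fin 2) F) (h : SpecialLinearGroup (Fin 2) F) (p q : F) : Prop :=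
  q ≠ 0 ∧ matOf h * M = (p • (1 : Matrix (Fin 2) (Fin 2) F) + q • M) * matOf h

theorem Nrm.mul {M : Matrix (Fin 2) (Fin 2) F} {x y : SpecialLinearGroup (Fin 2) F}
    {p q p' q' : F} (hx : Nrm M x p q) (hy : Nrm M y p' q') :
    Nrm M (x * y) (p' + q' * p) (q' * q) := by
  refine ⟨mul_ne_zero hy.1 hx.1, ?_⟩
  rw [matOf_mul, mul_assoc, hy.2, ← mul_assoc, mul_add]
  simp only [mul_smul_comm, mul_one, hx.2, add_mul, smul_mul_assoc, one_mul, smul_add, smul_smul,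
    add_smul, mul_assoc]
  abel

theorem Nrm.inv {M : Matrix (Fin 2) (Fin 2) F} {x : SpecialLinearGroup (Fin 2) F}
    {p q : F} (hx : Nrm M x p q) : Nrm M x⁻¹ (-p / q) (q⁻¹) := by
  obtain ⟨hq, h⟩ := hx
  refine ⟨inv_ne_zero hq, ?_⟩
  have h1 : matOf x⁻¹ * matOf x = 1 := by rw [← matOf_mul]; simp
  have h2 : matOf x * matOf x⁻¹ = 1 := by rw [← matOf_mul]; simp
  have h3 : M = p • (1 : Matrix (Fin 2) (Fin 2) F) + q • (matOf x⁻¹ * M * matOf x) := by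
    have := congrArg (fun Z => matOf x⁻¹ * Z) h
    simp only [← mul_assoc, h1, one_mul, mul_add, add_mul, mul_smul_comm, smul_mul_assoc] at this
    simpa [mul_assoc] using this
  have h4 : matOf x⁻¹ * M * matOf x = (-p / q) • (1 : Matrix (Fin 2) (Fin 2) F) + q⁻¹ • M := by
    conv_rhs => rw [h3]
    rw [smul_add, smul_smul, smul_smul, inv_mul_cancel₀ hq, one_smul, ← add_assoc, ← add_smul]
    have : -p / q + q⁻¹ * p = 0 := by field_simp; ring
    rw [this, zero_smul, zero_add]
  rw [← h4, mul_assoc, h2, mul_one]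

theorem nrm_of_comm {M : Matrix (Fin 2) (Fin 2) F} (hM : NotScalarMat M)
    {x : SpecialLinearGroup (Fin 2) F}
    (h : M * (matOf x * M * matOf x⁻¹) = (matOf x * M * matOf x⁻¹) * M) : ∃ p q, Nrm M x p q := by
  obtain ⟨p, q, hpq⟩ := comm_form hM h
  have h1 : matOf x⁻¹ * matOf x = 1 := by rw [← matOf_mul]; simp
  have h5 : matOf x * M = (p • (1 : Matrix (Fin 2) (Fin 2) F) + q • M) * matOf x := by
    rw [← hpq, mul_assoc, h1, mul_one]
  refine ⟨p, q, ?_, h5⟩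
  rintro rfl
  have h6 : M = p • (1 : Matrix (Fin 2) (Fin 2) F) := by
    have := congrArg (fun Z => matOf x⁻¹ * Z) h5
    simpa [← mul_assoc, h1] using this
  rw [h6] at hM
  simp [NotScalarMat] at hM

variable [CharP F 2]

theorem sq_inj {a b : F} (h : a ^ 2 = b ^ 2) : a = b := by
  have : (a + b) ^ 2 = 0 := by
    rw [CharTwo.add_sq, h, CharTwo.add_self_eq_zero]
  exact CharTwo.add_eq_zero.1 (pow_eq_zero_iff two_ne_zero |>.1 this)

theorem Nrm.eqs {M : Matrix (Fin 2) (Fin 2) F} {x : SpecialLinearGroup (Fin 2) F}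
    {p q : F} (hx : Nrm M x p q) :
    q * M.trace = M.trace ∧ p ^ 2 + p * q * M.trace + q ^ 2 * M.det = M.det := by
  obtain ⟨h1, h2⟩ := conj_tr_det hx.2
  constructor
  · simp [Matrix.trace_fin_two] at h1 ⊢
    linear_combination h1 - p * (CharTwo.two_eq_zero (R := F))
  · simp [Matrix.trace_fin_two, Matrix.det_fin_two] at h2 ⊢
    linear_combination h2

theorem Nrm.symm_coef {M : Matrix (Fin 2) (Fin 2) F} {x y : SpecialLinearGroup (Fin 2) F}
    {p q p' q' : F} (hx : Nrm M x p q) (hy : Nrm M y p' q') : p' + q' * p = p + q * p' := by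
  obtain ⟨h1, h2⟩ := hx.eqs
  obtain ⟨h3, h4⟩ := hy.eqs
  by_cases ht : M.trace = 0
  · apply sq_inj
    rw [ht] at h2 h4
    rw [CharTwo.add_sq, CharTwo.add_sq]
    linear_combination (1-q^2) * h4 - (1-q'^2) * h2
  · have e1 : q = 1 := mul_right_cancel₀ ht (by rw [h1, one_mul])
    have e2 : q' = 1 := mul_right_cancel₀ ht (by rw [h3, one_mul])
    rw [e1, e2]; ring

theorem Nrm.commutator {M : Matrix (Fin 2) (Fin 2) F} {x y : SpecialLinearGroup (Fin 2) F}
    {p q p' q' : F} (hx : Nrm M x p q) (hy : Nrm M y p' q') :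
    M * matOf ⁅x, y⁆ = matOf ⁅x, y⁆ * M := by
  have a1 := (hx.mul hy).2
  have a2 := (hy.mul hx).2
  rw [← hx.symm_coef hy, mul_comm q q'] at a2
  have hc : x * y = ⁅x, y⁆ * (y * x) := by simp [commutatorElement_def]
  set c := ⁅x, y⁆
  set P := p' + q' * p
  have hQ : q' * q ≠ 0 := mul_ne_zero hy.1 hx.1
  set Q := q' * q
  rw [hc, matOf_mul, mul_assoc, a2, ← mul_assoc, ← mul_assoc] at a1
  have h2 : matOf (y * x) * matOf (y * x)⁻¹ = 1 := by rw [← matOf_mul]; simp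
  have a3 := congrArg (fun Z => Z * matOf (y * x)⁻¹) a1
  simp only [mul_assoc, h2, mul_one] at a3
  rw [mul_add, add_mul] at a3
  simp only [mul_smul_comm, mul_one, smul_mul_assoc, one_mul, add_right_inj] at a3
  exact (smul_right_injective _ hQ a3).symm

/-- Normaliser subgroup of the algebra generated by `M`. -/
def nrmSubgroup (M : Matrix (Fin 2) (Fin 2) F) : Subgroup (SpecialLinearGroup (Fin 2) F) where
  carrier := {x | ∃ p q, Nrm M x p q}
  mul_mem' := by
    rintro x y ⟨p, q, h⟩ ⟨p', q', h'⟩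
    exact ⟨_, _, h.mul h'⟩
  one_mem' := ⟨0, 1, one_ne_zero, by simp⟩
  inv_mem' := by
    rintro x ⟨p, q, h⟩
    exact ⟨_, _, h.inv⟩

/-- Centraliser subgroup of `M`. -/
def cenSubgroup (M : Matrix (Fin 2) (Fin 2) F) : Subgroup (SpecialLinearGroup (Fin 2) F) where
  carrier := {x | M * matOf x = matOf x * M}
  mul_mem' := by
    intro x y hx hy
    simp only [Set.mem_ofPred_eq, matOf_mul] at *
    rw [← mul_assoc, hx, mul_assoc, hy, mul_assoc]
  one_mem' := by simp
  inv_mem' := by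
    intro x hx
    simp only [Set.mem_ofPred_eq] at *
    have h1 : matOf x⁻¹ * matOf x = 1 := by rw [← matOf_mul]; simp
    have h2 : matOf x * matOf x⁻¹ = 1 := by rw [← matOf_mul]; simp
    calc M * matOf x⁻¹ = matOf x⁻¹ * (matOf x * M) * matOf x⁻¹ := by rw [← mul_assoc, h1, one_mul]
      _ = _ := by rw [← hx, mul_assoc, mul_assoc, h2, mul_one]

theorem solvable_of_nrm {M : Matrix (Fin 2) (Fin 2) F} (hM : NotScalarMat M)
    {x y : SpecialLinearGroup (Fin 2) F} (hx : ∃ p q, Nrm M x p q) (hy : ∃ p q, Nrm M y p q) :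
    Group.IsSolvable (Subgroup.closure {x, y}) := by
  have hle : Subgroup.closure {x, y} ≤ nrmSubgroup M := by
    rw [Subgroup.closure_le]
    rintro z (rfl | rfl)
    · exact hx
    · exact hy
  refine solvable_of_commutator_mem _ (cenSubgroup M) ?_ ?_
  · intro a ha b hb
    exact matOf_inj (comm_comm hM ha hb)
  · intro h hh k hk
    obtain ⟨p, q, h1⟩ := hle hh
    obtain ⟨p', q', h2⟩ := hle hk
    exact h1.commutator h2

end MatAux

section Criterion
open Matrix
open scoped commutatorElement

variable {F : Type*} [Field F] [CharP F 2]

/-- The trace criterion for solvability of `⟨x, y⟩`. -/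
def Crit (α β γ : F) : Prop :=
  α ^ 2 + β ^ 2 + γ ^ 2 + α * β * γ = 0 ∨ (α = 0 ∧ β = 0) ∨ (α = 0 ∧ γ = 0) ∨ (β = 0 ∧ γ = 0)

theorem det_comm (X Y : Matrix (Fin 2) (Fin 2) F) (hX : X.det = 1) (hY : Y.det = 1) :
    (X * Y - Y * X).det = X.trace ^ 2 + Y.trace ^ 2 + (X * Y).trace ^ 2 +
      X.trace * Y.trace * (X * Y).trace := by
  have key : (X * Y - Y * X).det = 4 * X.det * Y.det - X.trace ^ 2 * Y.det - Y.trace ^ 2 * X.det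
      - (X * Y).trace ^ 2 + X.trace * Y.trace * (X * Y).trace := by
    simp [Matrix.trace_fin_two, Matrix.det_fin_two, Matrix.mul_apply, Fin.sum_univ_two]
    ring
  rw [key, hX, hY]
  linear_combination (2 - X.trace ^ 2 - Y.trace ^ 2 - (X * Y).trace ^ 2) *
    (CharTwo.two_eq_zero (R := F))

theorem comm_id (A B : Matrix (Fin 2) (Fin 2) F) :
    (A * B - B * A) * A = (A.trace • (1 : Matrix (Fin 2) (Fin 2) F) - A) * (A * B - B * A) := by
  ext i j
  fin_cases i <;> fin_cases j <;>
    simp [Matrix.trace_fin_two, Matrix.mul_apply, Fin.sum_univ_two] <;> ring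

theorem polar (X Y : Matrix (Fin 2) (Fin 2) F) :
    X * Y = Y * X + X.trace • Y + Y.trace • X +
      ((X * Y).trace + X.trace * Y.trace) • (1 : Matrix (Fin 2) (Fin 2) F) := by
  have h2 := CharTwo.two_eq_zero (R := F)
  ext i j
  fin_cases i <;> fin_cases j <;>
    simp [Matrix.trace_fin_two, Matrix.mul_apply, Fin.sum_univ_two]
  · linear_combination (- (Y 0 0 * X 0 0 + Y 0 1 * X 1 0) -
      (X 0 0 + X 1 1) * (Y 0 0 + Y 1 1)) * h2
  · linear_combination (- (Y 0 0 * X 0 1 + Y 0 1 * X 1 1)) * h2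
  · linear_combination (- (Y 1 0 * X 0 0 + Y 1 1 * X 1 0)) * h2
  · linear_combination (- (Y 1 0 * X 0 1 + Y 1 1 * X 1 1) -
      (X 0 0 + X 1 1) * (Y 0 0 + Y 1 1)) * h2

theorem notScalar_of_not_comm {A B : Matrix (Fin 2) (Fin 2) F} (h : A * B ≠ B * A) :
    NotScalarMat A := by
  by_contra hA
  simp only [NotScalarMat, not_or, not_not] at hA
  obtain ⟨h1, h2, h3⟩ := hA
  apply h
  ext i j
  fin_cases i <;> fin_cases j <;>
    simp [Matrix.mul_apply, Fin.sum_univ_two, h1, h2, h3] <;> ring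

theorem matOf_inv (x : SpecialLinearGroup (Fin 2) F) :
    matOf x⁻¹ = (matOf x).trace • (1 : Matrix (Fin 2) (Fin 2) F) - matOf x := by
  have : matOf x⁻¹ = (matOf x).adjugate := Matrix.SpecialLinearGroup.coe_inv x
  rw [this, Matrix.adjugate_fin_two]
  ext i j
  fin_cases i <;> fin_cases j <;> simp [Matrix.trace_fin_two]

theorem nrm_of_nilp {D : Matrix (Fin 2) (Fin 2) F} (hD : NotScalarMat D) (hD2 : D * D = 0)
    (x : SpecialLinearGroup (Fin 2) F)
    (h : D * matOf x = ((matOf x).trace • (1 : Matrix (Fin 2) (Fin 2) F) - matOf x) * D) :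
    ∃ p q, Nrm D x p q := by
  have h' : D * matOf x⁻¹ = matOf x * D := by
    rw [matOf_inv, mul_sub, h, sub_mul]
    simp
  rw [← matOf_inv] at h
  apply nrm_of_comm hD
  have e1 : D * (matOf x * D * matOf x⁻¹) = 0 := by
    rw [← mul_assoc, ← mul_assoc, h, mul_assoc _ D D, hD2]; simp
  have e2 : matOf x * D * matOf x⁻¹ * D = 0 := by
    rw [mul_assoc (matOf x), h', mul_assoc, mul_assoc, hD2]; simp
  rw [e1, e2]

theorem solvable_of_crit {x y : SpecialLinearGroup (Fin 2) F}
    (h : Crit (matOf x).trace (matOf y).trace (matOf x * matOf y).trace) :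
    Group.IsSolvable (Subgroup.closure {x, y}) := by
  have h2 := CharTwo.two_eq_zero (R := F)
  by_cases hc : matOf x * matOf y = matOf y * matOf x
  · have hxy : x * y = y * x := matOf_inj (by rw [matOf_mul, matOf_mul, hc])
    apply solvable_of_commutator_mem _ ⊥
    · intro a ha b hb
      rw [Subgroup.mem_bot] at ha hb
      rw [ha, hb]
    · intro a ha b hb
      rw [Subgroup.mem_bot, commutatorElement_eq_one_iff_mul_comm]
      have hle : Subgroup.closure {x, y} ≤ Subgroup.centralizer {x, y} := by
        rw [Subgroup.closure_le]
        rintro z (rfl | rfl) w (rfl | rfl) <;> simp [hxy]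
      have hle2 : Subgroup.closure {x, y} ≤
          Subgroup.centralizer (Subgroup.closure {x, y} : Set (SpecialLinearGroup (Fin 2) F)) := by
        rw [Subgroup.closure_le]
        intro z hz w hw
        exact (hle hw z hz).symm
      exact (hle2 ha b hb).symm
  have nX : NotScalarMat (matOf x) := notScalar_of_not_comm hc
  have nY : NotScalarMat (matOf y) := notScalar_of_not_comm (Ne.symm hc)
  have hp := polar (matOf x) (matOf y)
  have hp' := polar (matOf y) (matOf x)
  rcases h with h | ⟨h1, h3⟩ | ⟨h1, h3⟩ | ⟨h1, h3⟩
  · have hdet := det_comm (matOf x) (matOf y) (by simp) (by simp)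
    rw [h] at hdet
    have id1 := comm_id (matOf x) (matOf y)
    have id2 := comm_id (matOf y) (matOf x)
    have hD0 : matOf x * matOf y - matOf y * matOf x ≠ 0 := sub_ne_zero.2 hc
    have htr : (matOf x * matOf y - matOf y * matOf x).trace = 0 := by
      rw [Matrix.trace_sub, Matrix.trace_mul_comm, sub_self]
    have hneg : matOf y * matOf x - matOf x * matOf y =
      -(matOf x * matOf y - matOf y * matOf x) := by abel
    rw [hneg] at id2
    rw [neg_mul, mul_neg, neg_inj] at id2
    generalize matOf x * matOf y - matOf y * matOf x = D at *
    rw [Matrix.trace_fin_two] at htr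
    rw [Matrix.det_fin_two] at hdet
    have hD2 : D * D = 0 := by
      ext i j
      fin_cases i <;> fin_cases j <;> simp [Matrix.mul_apply, Fin.sum_univ_two]
      · linear_combination D 0 0 * htr - hdet
      · linear_combination D 0 1 * htr
      · linear_combination D 1 0 * htr
      · linear_combination D 1 1 * htr - hdet
    have nD : NotScalarMat D := by
      by_contra hA
      simp only [NotScalarMat, not_or, not_not] at hA
      obtain ⟨g1, g2, g3⟩ := hA
      rw [g1, g3, zero_mul, sub_zero, mul_self_eq_zero] at hdet
      rw [hdet] at g3
      apply hD0
      ext i j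
      fin_cases i <;> fin_cases j <;> simp [g1, g2, g3, hdet]
    exact solvable_of_nrm nD (nrm_of_nilp nD hD2 x id1) (nrm_of_nilp nD hD2 y id2)
  · have sq : ∀ z : SpecialLinearGroup (Fin 2) F, (matOf z).trace = 0 → matOf z * matOf z = 1 := by
      intro z hz
      have e := matOf_inv z
      have e2 : matOf z * matOf z⁻¹ = 1 := by rw [← matOf_mul]; simp
      rw [e, hz] at e2
      rw [← e2]
      ext i j
      simp [CharTwo.neg_eq]
    have sx := sq x h1
    have sy := sq y h3
    rw [h1, h3] at hp
    simp only [zero_smul, add_zero, mul_zero] at hp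
    have nM : NotScalarMat (matOf x * matOf y) := by
      apply notScalar_of_not_comm (B := matOf x)
      intro h'
      apply hc
      have := congrArg (fun Z => matOf x * Z) h'
      simp only [← mul_assoc, sx, one_mul] at this
      exact this.symm
    generalize (matOf x * matOf y).trace = γ at *
    have dbl : ∀ Z : Matrix (Fin 2) (Fin 2) F, Z + Z = 0 := by
      intro Z; ext i j; simp [CharTwo.add_self_eq_zero]
    refine solvable_of_nrm nM ⟨γ, 1, one_ne_zero, ?_⟩ ⟨γ, 1, one_ne_zero, ?_⟩
    · rw [one_smul, ← mul_assoc, sx, one_mul, hp, add_mul, add_mul, mul_assoc, sx]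
      simp only [smul_mul_assoc, one_mul, mul_one]
      rw [add_comm (matOf y), ← add_assoc, dbl, zero_add]
    · have hp2 : matOf y * matOf x = γ • (1 : Matrix (Fin 2) (Fin 2) F) + matOf x * matOf y := by
        rw [hp, add_comm (matOf y * matOf x), ← add_assoc, dbl, zero_add]
      rw [one_smul, ← hp2, mul_assoc]
  · rw [h1, h3] at hp
    refine solvable_of_nrm nY ⟨(matOf y).trace, 1, one_ne_zero, ?_⟩ ⟨0, 1, one_ne_zero, by simp⟩
    rw [hp]
    simp [add_mul, add_comm]
  · rw [Matrix.trace_mul_comm (matOf y), h1, h3] at hp'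
    refine solvable_of_nrm nX ⟨0, 1, one_ne_zero, by simp⟩ ⟨(matOf x).trace, 1, one_ne_zero, ?_⟩
    rw [hp']
    simp [add_mul, add_comm]

theorem nrm_comm_or {M : Matrix (Fin 2) (Fin 2) F} (ht : M.trace ≠ 0)
    {x : SpecialLinearGroup (Fin 2) F} (hx : ∃ p q, Nrm M x p q) :
    x ∈ cenSubgroup M ∨ (matOf x).trace = 0 := by
  obtain ⟨p, q, h⟩ := hx
  obtain ⟨h1, h2⟩ := h.eqs
  have e1 : q = 1 := mul_right_cancel₀ ht (by rw [h1, one_mul])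
  subst e1
  have h3 : p * (p + M.trace) = 0 := by linear_combination h2
  have h4 := h.2
  rcases mul_eq_zero.1 h3 with rfl | h5
  · left
    simp only [zero_smul, one_smul, zero_add] at h4
    exact h4.symm
  · right
    rw [CharTwo.add_eq_zero] at h5
    have h6 := congrArg Matrix.trace h4
    rw [Matrix.trace_mul_comm, add_mul, Matrix.trace_add, one_smul, smul_mul_assoc, one_mul,
      right_eq_add, Matrix.trace_smul, smul_eq_mul, h5] at h6
    exact (mul_eq_zero.1 h6).resolve_left ht

theorem crit_of_nrm {M : Matrix (Fin 2) (Fin 2) F} (hM : NotScalarMat M)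
    {x y : SpecialLinearGroup (Fin 2) F} (hx : ∃ p q, Nrm M x p q) (hy : ∃ p q, Nrm M y p q) :
    Crit (matOf x).trace (matOf y).trace (matOf x * matOf y).trace := by
  have hdet := det_comm (matOf x) (matOf y) (by simp) (by simp)
  by_cases ht : M.trace = 0
  · left
    rw [← hdet]
    obtain ⟨p, q, h⟩ := hx
    obtain ⟨p', q', h'⟩ := hy
    obtain ⟨u, v, huv⟩ := comm_form hM (h.commutator h')
    have hc : x * y = ⁅x, y⁆ * (y * x) := by simp [commutatorElement_def]
    have htc : (matOf ⁅x, y⁆).trace = 0 := by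
      rw [huv, Matrix.trace_add, Matrix.trace_smul, Matrix.trace_smul, ht, Matrix.trace_one]
      simp [CharTwo.two_eq_zero]
    have hD : matOf x * matOf y - matOf y * matOf x = (matOf ⁅x, y⁆ - 1) * matOf (y * x) := by
      rw [sub_mul, ← matOf_mul, ← matOf_mul, ← matOf_mul, ← hc, one_mul]
    rw [hD, Matrix.det_mul, matOf_det, mul_one]
    have hdc : (matOf ⁅x, y⁆).det = 1 := matOf_det _
    rw [Matrix.det_fin_two] at hdc ⊢
    rw [Matrix.trace_fin_two] at htc
    simp
    linear_combination hdc - htc + CharTwo.two_eq_zero (R := F)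
  · have hcomm : x ∈ cenSubgroup M → y ∈ cenSubgroup M →
        Crit (matOf x).trace (matOf y).trace (matOf x * matOf y).trace := by
      intro h1 h2
      left
      rw [← hdet, comm_comm hM h1 h2, sub_self]
      simp
    have hxy : ∃ p q, Nrm M (x * y) p q := (nrmSubgroup M).mul_mem hx hy
    have hxy' := nrm_comm_or ht hxy
    rw [matOf_mul] at hxy'
    rcases nrm_comm_or ht hx with h1 | h1 <;> rcases nrm_comm_or ht hy with h2 | h2
    · exact hcomm h1 h2
    · rcases hxy' with h3 | h3
      · exact hcomm h1 ((Subgroup.mul_mem_cancel_left _ h1).1 h3)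
      · exact Or.inr (Or.inr (Or.inr ⟨h2, h3⟩))
    · rcases hxy' with h3 | h3
      · exact hcomm ((Subgroup.mul_mem_cancel_right _ h2).1 h3) h2
      · exact Or.inr (Or.inr (Or.inl ⟨h1, h3⟩))
    · exact Or.inr (Or.inl ⟨h1, h2⟩)

theorem notScalar_of_ne_one {a : SpecialLinearGroup (Fin 2) F} (ha : a ≠ 1) :
    NotScalarMat (matOf a) := by
  by_contra hA
  simp only [NotScalarMat, not_or, not_not] at hA
  obtain ⟨g1, g2, g3⟩ := hA
  have hd := matOf_det a
  rw [Matrix.det_fin_two, g1, g3, zero_mul, sub_zero] at hd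
  have h1 : matOf a 1 1 = 1 := sq_inj (by rw [sq, hd]; simp)
  apply ha
  apply matOf_inj
  ext i j
  fin_cases i <;> fin_cases j <;> simp [g1, g2, g3, h1]

theorem crit_of_solvable {x y : SpecialLinearGroup (Fin 2) F}
    (h : Group.IsSolvable (Subgroup.closure {x, y})) :
    Crit (matOf x).trace (matOf y).trace (matOf x * matOf y).trace := by
  have hx : x ∈ Subgroup.closure {x, y} := Subgroup.subset_closure (by simp)
  have hy : y ∈ Subgroup.closure {x, y} := Subgroup.subset_closure (by simp)
  rcases subsingleton_or_nontrivial (Subgroup.closure {x, y}) with hs | hs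
  · have hx1 : x = 1 := congrArg Subtype.val (Subsingleton.elim (⟨x, hx⟩ : Subgroup.closure {x, y}) 1)
    have hy1 : y = 1 := congrArg Subtype.val (Subsingleton.elim (⟨y, hy⟩ : Subgroup.closure {x, y}) 1)
    right; left
    rw [hx1, hy1]
    simp [CharTwo.two_eq_zero]
  · obtain ⟨a, ha, hc⟩ := exists_abelian_normal (H := Subgroup.closure {x, y})
    have ha' : a.1 ≠ 1 := fun h => ha (Subtype.ext h)
    have nM := notScalar_of_ne_one ha'
    have key : ∀ z, z ∈ Subgroup.closure {x, y} → ∃ p q, Nrm (matOf a.1) z p q := by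
      intro z hz
      apply nrm_of_comm nM
      have := congrArg (fun w => matOf w) (congrArg Subtype.val (hc ⟨z, hz⟩))
      simp only [Subgroup.coe_mul, Subgroup.coe_inv, matOf_mul] at this
      exact this.symm
    exact crit_of_nrm nM (key x hx) (key y hy)

theorem mem_solvabilizer_iff {x y : SpecialLinearGroup (Fin 2) F} :
    y ∈ solvabilizer x ↔ Crit (matOf x).trace (matOf y).trace (matOf x * matOf y).trace :=
  ⟨fun h => crit_of_solvable h, fun h => solvable_of_crit h⟩

end Criterion

section Count
open Matrix

variable {F : Type*} [Field F] [CharP F 2]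

theorem affine_aux {ω : F} (h0 : ω ≠ 0) (h1 : ω ≠ 1) {e f e' f' : F}
    (he : f = 0 → e = 0 ∨ e = 1) (he' : f' = 0 → e' = 0 ∨ e' = 1)
    (H : ∀ u, (e + f * u = 0 ∨ e + f * u = 1) ↔ (e' + f' * u = 0 ∨ e' + f' * u = 1)) : f = f' := by
  have key : ∀ {e f e' f' : F}, (f = 0 → e = 0 ∨ e = 1) →
      (∀ u, (e + f * u = 0 ∨ e + f * u = 1) → (e' + f' * u = 0 ∨ e' + f' * u = 1)) →
      f = 0 → f' = 0 := by
    intro e f e' f' he H hf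
    by_contra hf'
    have := H ((ω - e') / f') (by simpa [hf] using he hf)
    have e1 : e' + f' * ((ω - e') / f') = ω := by field_simp; ring
    rw [e1] at this
    exact this.elim h0 h1
  by_cases hf : f = 0
  · rw [key he (fun u => (H u).1) hf, hf]
  by_cases hf' : f' = 0
  · exact absurd (key he' (fun u => (H u).2) hf') hf
  have a1 := (H (-e / f)).1 (Or.inl (by field_simp; ring))
  have a2 := (H ((1 - e) / f)).1 (Or.inr (by field_simp; ring))
  have e3 : e' + f' * ((1 - e) / f) = e' + f' * (-e / f) + f' / f := by field_simp; ring
  rw [e3] at a2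
  have hne : f' / f ≠ 0 := div_ne_zero hf' hf
  have h11 : (1 : F) + 1 = 0 := CharTwo.add_self_eq_zero 1
  have : f' / f = 1 := by
    rcases a1 with a1 | a1 <;> rw [a1] at a2 <;> rcases a2 with a2 | a2
    · exact absurd (by simpa using a2) hne
    · simpa using a2
    · linear_combination a2 - h11
    · exact absurd (by linear_combination a2) hne
  exact ((div_eq_one_iff_eq hf).1 this).symm

/-- The invariant which classifies solvabilizers. -/
noncomputable def invP (x : SpecialLinearGroup (Fin 2) F) : (F × F) ⊕ (F × F) :=
  open Classical in
  if (matOf x).trace = 0 then Sum.inl (matOf x 0 1, matOf x 1 0)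
  else Sum.inr (matOf x 0 1 / (matOf x).trace, matOf x 1 0 / (matOf x).trace)

theorem exists_matOf (a b c d : F) (h : a * d - b * c = 1) :
    ∃ x : SpecialLinearGroup (Fin 2) F, matOf x = !![a, b; c, d] :=
  ⟨⟨!![a, b; c, d], by rw [Matrix.det_fin_two]; simpa using h⟩, rfl⟩

theorem invP_surjective {ω : F} (h0 : ω ≠ 0) (h1 : ω ≠ 1) (hsq : ∀ a : F, ∃ b, b ^ 2 = a) :
    Function.Surjective (invP (F := F)) := by
  have h2 := CharTwo.two_eq_zero (R := F)
  rintro (⟨b, c⟩ | ⟨b, c⟩)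
  · obtain ⟨s, hs⟩ := hsq (1 + b * c)
    obtain ⟨x, hx⟩ := exists_matOf s b c s (by linear_combination hs)
    refine ⟨x, ?_⟩
    have ht : (matOf x).trace = 0 := by
      rw [hx, Matrix.trace_fin_two]; simp [CharTwo.add_self_eq_zero]
    rw [invP, if_pos ht, hx]
    simp
  · have hu : ∃ u : F, u ^ 2 + u + b * c ≠ 0 := by
      by_cases hbc : b * c = 0
      · refine ⟨ω, ?_⟩
        rw [hbc, add_zero]
        intro h
        have : ω * (ω + 1) = 0 := by linear_combination h
        rcases mul_eq_zero.1 this with h | h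
        · exact h0 h
        · exact h1 (CharTwo.add_eq_zero.1 h)
      · exact ⟨0, by simpa using hbc⟩
    obtain ⟨u, hu⟩ := hu
    obtain ⟨v, hv⟩ := hsq (u ^ 2 + u + b * c)
    have hv0 : v ≠ 0 := by
      rintro rfl
      apply hu
      rw [← hv]; simp
    obtain ⟨x, hx⟩ := exists_matOf (u / v) (b / v) (c / v) ((u + 1) / v) (by
      field_simp
      linear_combination (-1) * hv - b * c * h2)
    refine ⟨x, ?_⟩
    have ht : (matOf x).trace = 1 / v := by
      rw [hx, Matrix.trace_fin_two]; simp
      field_simp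
      linear_combination u * h2
    have ht' : (matOf x).trace ≠ 0 := by rw [ht]; exact one_div_ne_zero hv0
    rw [invP, if_neg ht', ht, hx]
    simp [hv0]

theorem crit_transfer {x x' y : SpecialLinearGroup (Fin 2) F} (hx : (matOf x).trace ≠ 0)
    (hx' : (matOf x').trace ≠ 0)
    (hb : matOf x 0 1 / (matOf x).trace = matOf x' 0 1 / (matOf x').trace)
    (hc : matOf x 1 0 / (matOf x).trace = matOf x' 1 0 / (matOf x').trace)
    (h : Crit (matOf x).trace (matOf y).trace (matOf x * matOf y).trace) :
    Crit (matOf x').trace (matOf y).trace (matOf x' * matOf y).trace := by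
  have h2 := CharTwo.two_eq_zero (R := F)
  obtain ⟨q, hq⟩ : ∃ q, q = (matOf x').trace / (matOf x).trace := ⟨_, rfl⟩
  obtain ⟨p, hp⟩ : ∃ p, p = matOf x' 0 0 - q * matOf x 0 0 := ⟨_, rfl⟩
  have ht : (matOf x').trace = q * (matOf x).trace := by rw [hq]; field_simp
  have hb' : matOf x' 0 1 = q * matOf x 0 1 := by rw [hq]; field_simp at hb ⊢; linear_combination -hb
  have hc' : matOf x' 1 0 = q * matOf x 1 0 := by rw [hq]; field_simp at hc ⊢; linear_combination -hc
  have ht2 := ht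
  rw [Matrix.trace_fin_two, Matrix.trace_fin_two] at ht2
  have hform : matOf x' = p • (1 : Matrix (Fin 2) (Fin 2) F) + q • matOf x := by
    ext i j
    fin_cases i <;> fin_cases j <;> simp [hb', hc']
    · rw [hp]; ring
    · rw [hp]; linear_combination ht2 + (q * matOf x 0 0 - matOf x' 0 0) * h2
  have hg : (matOf x' * matOf y).trace = p * (matOf y).trace + q * (matOf x * matOf y).trace := by
    rw [hform, add_mul, Matrix.trace_add, smul_mul_assoc, smul_mul_assoc, one_mul,
      Matrix.trace_smul, Matrix.trace_smul, smul_eq_mul, smul_eq_mul]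
  have hd : p ^ 2 + p * q * (matOf x).trace + q ^ 2 = 1 := by
    have d1 := matOf_det x'
    have d2 := matOf_det x
    rw [hform] at d1
    rw [Matrix.det_fin_two] at d1 d2
    rw [Matrix.trace_fin_two]
    simp at d1
    linear_combination d1 - q ^ 2 * d2
  rw [hg, ht]
  generalize (matOf x).trace = α at *
  generalize (matOf y).trace = β at *
  generalize (matOf x * matOf y).trace = γ at *
  rcases h with h | ⟨h1, h3⟩ | ⟨h1, h3⟩ | ⟨h1, h3⟩
  · left
    linear_combination q ^ 2 * h + β ^ 2 * hd + (p * β * q * γ + β ^ 2 - β ^ 2 * q ^ 2) * h2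
  · exact absurd h1 hx
  · exact absurd h1 hx
  · right; right; right
    simp [h1, h3]

theorem sol_eq_of_invP {x x' : SpecialLinearGroup (Fin 2) F} (h : invP x = invP x') :
    solvabilizer x = solvabilizer x' := by
  unfold invP at h
  split_ifs at h with h1 h2 h2
  · rw [Sum.inl.injEq, Prod.mk.injEq] at h
    obtain ⟨hb, hc⟩ := h
    have d1 := matOf_det x'
    have d2 := matOf_det x
    rw [Matrix.det_fin_two] at d1 d2
    rw [Matrix.trace_fin_two, CharTwo.add_eq_zero] at h1 h2
    have : x = x' := by
      apply matOf_inj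
      have h00 : matOf x 0 0 = matOf x' 0 0 := by
        apply sq_inj
        rw [← h1, hb, hc] at d2
        rw [← h2] at d1
        linear_combination d2 - d1
      ext i j
      fin_cases i <;> fin_cases j <;> simp [hb, hc, h00, ← h1, ← h2]
    rw [this]
  · rw [Sum.inr.injEq, Prod.mk.injEq] at h
    ext y
    rw [mem_solvabilizer_iff, mem_solvabilizer_iff]
    exact ⟨crit_transfer h1 h2 h.1 h.2, crit_transfer h2 h1 h.1.symm h.2.symm⟩

theorem crit_zero_left {β γ : F} (hβ : β ≠ 0) : Crit 0 β γ ↔ γ = 0 ∨ γ = β := by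
  constructor
  · rintro (h | h | h | h)
    · right
      apply sq_inj
      have h2 := CharTwo.two_eq_zero (R := F)
      linear_combination h - β ^ 2 * h2
    · exact absurd h.2 hβ
    · exact Or.inl h.2
    · exact absurd h.1 hβ
  · rintro (rfl | rfl)
    · right; right; left; simp
    · left
      have h2 := CharTwo.two_eq_zero (R := F)
      linear_combination γ ^ 2 * h2

theorem crit_zero_mid {α γ : F} (hα : α ≠ 0) : Crit α 0 γ ↔ γ = 0 ∨ γ = α := by
  constructor
  · rintro (h | h | h | h)
    · right
      apply sq_inj
      have h2 := CharTwo.two_eq_zero (R := F)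
      linear_combination h - α ^ 2 * h2
    · exact absurd h.1 hα
    · exact absurd h.1 hα
    · exact Or.inl h.2
  · rintro (rfl | rfl)
    · right; right; right; simp
    · left
      have h2 := CharTwo.two_eq_zero (R := F)
      linear_combination γ ^ 2 * h2

/-- Lower and upper triangular test elements against trace zero elements. -/
theorem exists_test_zero {ω : F} (h0 : ω ≠ 0) (h1 : ω ≠ 1) (u : F) :
    ∃ y y' : SpecialLinearGroup (Fin 2) F, ∀ x : SpecialLinearGroup (Fin 2) F,
      (matOf x).trace = 0 →
      (y ∈ solvabilizer x ↔ matOf x 0 0 + matOf x 0 1 * u = 0 ∨ matOf x 0 0 + matOf x 0 1 * u = 1) ∧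
      (y' ∈ solvabilizer x ↔
        matOf x 0 0 + matOf x 1 0 * u = 0 ∨ matOf x 0 0 + matOf x 1 0 * u = 1) := by
  obtain ⟨β, hβ⟩ : ∃ β, β = ω + ω⁻¹ := ⟨_, rfl⟩
  have hβ0 : β ≠ 0 := by
    rw [hβ]
    intro h
    rw [CharTwo.add_eq_zero] at h
    apply h1
    apply sq_inj
    field_simp at h
    simpa using h
  obtain ⟨y, hy⟩ := exists_matOf ω 0 (β * u) ω⁻¹ (by field_simp; ring)
  obtain ⟨y', hy'⟩ := exists_matOf ω (β * u) 0 ω⁻¹ (by field_simp; ring)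
  have aux : ∀ z : F, (β * z = 0 ∨ β * z = β) ↔ (z = 0 ∨ z = 1) := by
    intro z
    simp [hβ0]
  refine ⟨y, y', fun x hx => ?_⟩
  have ty : (matOf y).trace = β := by rw [hy, Matrix.trace_fin_two, hβ]; simp
  have ty' : (matOf y').trace = β := by rw [hy', Matrix.trace_fin_two, hβ]; simp
  have hx2 := hx
  rw [Matrix.trace_fin_two, CharTwo.add_eq_zero] at hx2
  have g : (matOf x * matOf y).trace = β * (matOf x 0 0 + matOf x 0 1 * u) := by
    rw [hy, Matrix.trace_fin_two]
    simp [Matrix.mul_apply, Fin.sum_univ_two, ← hx2]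
    rw [hβ]; ring
  have g' : (matOf x * matOf y').trace = β * (matOf x 0 0 + matOf x 1 0 * u) := by
    rw [hy', Matrix.trace_fin_two]
    simp [Matrix.mul_apply, Fin.sum_univ_two, ← hx2]
    rw [hβ]; ring
  rw [mem_solvabilizer_iff, mem_solvabilizer_iff, hx, ty, ty', g, g', crit_zero_left hβ0,
    crit_zero_left hβ0, aux, aux]
  exact ⟨Iff.rfl, Iff.rfl⟩

/-- Unipotent test elements against elements of nonzero trace. -/
theorem exists_test_ne (u : F) :
    ∃ y y' : SpecialLinearGroup (Fin 2) F, (matOf y).trace = 0 ∧ (matOf y').trace = 0 ∧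
      ∀ x : SpecialLinearGroup (Fin 2) F, (matOf x).trace ≠ 0 →
      (y ∈ solvabilizer x ↔ 0 + matOf x 0 1 / (matOf x).trace * u = 0 ∨
        0 + matOf x 0 1 / (matOf x).trace * u = 1) ∧
      (y' ∈ solvabilizer x ↔ 0 + matOf x 1 0 / (matOf x).trace * u = 0 ∨
        0 + matOf x 1 0 / (matOf x).trace * u = 1) := by
  obtain ⟨y, hy⟩ := exists_matOf 1 0 u 1 (by ring)
  obtain ⟨y', hy'⟩ := exists_matOf 1 u 0 1 (by ring)
  have h11 : (1 : F) + 1 = 0 := CharTwo.add_self_eq_zero 1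
  have ty : (matOf y).trace = 0 := by rw [hy, Matrix.trace_fin_two]; simpa using h11
  have ty' : (matOf y').trace = 0 := by rw [hy', Matrix.trace_fin_two]; simpa using h11
  refine ⟨y, y', ty, ty', fun x hx => ?_⟩
  have g : (matOf x * matOf y).trace = (matOf x).trace + matOf x 0 1 * u := by
    rw [hy, Matrix.trace_fin_two, Matrix.trace_fin_two]
    simp [Matrix.mul_apply, Fin.sum_univ_two]
    ring
  have g' : (matOf x * matOf y').trace = (matOf x).trace + matOf x 1 0 * u := by
    rw [hy', Matrix.trace_fin_two, Matrix.trace_fin_two]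
    simp [Matrix.mul_apply, Fin.sum_univ_two]
    ring
  rw [mem_solvabilizer_iff, mem_solvabilizer_iff, ty, ty', g, g', crit_zero_mid hx,
    crit_zero_mid hx]
  generalize (matOf x).trace = α at *
  have aux : ∀ b : F, (α + b * u = 0 ∨ α + b * u = α) ↔
      (0 + b / α * u = 0 ∨ 0 + b / α * u = 1) := by
    intro b
    have e : 0 + b / α * u = (b * u) / α := by ring
    rw [e, div_eq_one_iff_eq hx, div_eq_zero_iff, CharTwo.add_eq_zero, add_eq_left, eq_comm (a := α)]
    tauto
  exact ⟨aux _, aux _⟩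

theorem sol_ne_aux {ω : F} (h0 : ω ≠ 0) (h1 : ω ≠ 1) {x x' : SpecialLinearGroup (Fin 2) F}
    (hx : (matOf x).trace = 0) (hx' : (matOf x').trace ≠ 0)
    (h : solvabilizer x = solvabilizer x') : False := by
  have all : ∀ y : SpecialLinearGroup (Fin 2) F, (matOf y).trace = 0 → y ∈ solvabilizer x' := by
    intro y hy
    rw [← h, mem_solvabilizer_iff]
    exact Or.inr (Or.inl ⟨hx, hy⟩)
  have hb : (0 : F) = matOf x' 0 1 / (matOf x').trace := by
    refine affine_aux (e := 0) (e' := 0) h0 h1 (by simp) (by simp) (fun u => ?_)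
    obtain ⟨y, y', ty, ty', H⟩ := exists_test_ne u
    simp only [zero_mul, add_zero, true_or, true_iff]
    simpa using (H x' hx').1.1 (all y ty)
  have hc : (0 : F) = matOf x' 1 0 / (matOf x').trace := by
    refine affine_aux (e := 0) (e' := 0) h0 h1 (by simp) (by simp) (fun u => ?_)
    obtain ⟨y, y', ty, ty', H⟩ := exists_test_ne u
    simp only [zero_mul, add_zero, true_or, true_iff]
    simpa using (H x' hx').2.1 (all y' ty')
  have hb' : matOf x' 0 1 = 0 := by
    rcases div_eq_zero_iff.1 hb.symm with h | h
    · exact h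
    · exact absurd h hx'
  have hc' : matOf x' 1 0 = 0 := by
    rcases div_eq_zero_iff.1 hc.symm with h | h
    · exact h
    · exact absurd h hx'
  obtain ⟨y, hy⟩ := exists_matOf ω 1 (ω ^ 2 - 1) ω (by ring)
  have ty : (matOf y).trace = 0 := by
    rw [hy, Matrix.trace_fin_two]; simp [CharTwo.add_self_eq_zero]
  have hm := all y ty
  have g : (matOf x' * matOf y).trace = (matOf x').trace * ω := by
    rw [hy, Matrix.trace_fin_two, Matrix.trace_fin_two]
    simp [Matrix.mul_apply, Fin.sum_univ_two, hb', hc']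
    ring
  rw [mem_solvabilizer_iff, ty, g, crit_zero_mid hx'] at hm
  rcases hm with hm | hm
  · exact (mul_ne_zero hx' h0) hm
  · exact h1 (mul_left_cancel₀ hx' (by rw [hm, mul_one]))

theorem invP_of_sol_eq {ω : F} (h0 : ω ≠ 0) (h1 : ω ≠ 1) {x x' : SpecialLinearGroup (Fin 2) F}
    (h : solvabilizer x = solvabilizer x') : invP x = invP x' := by
  unfold invP
  by_cases hx : (matOf x).trace = 0 <;> by_cases hx' : (matOf x').trace = 0
  · rw [if_pos hx, if_pos hx']
    have deg : ∀ z : SpecialLinearGroup (Fin 2) F, (matOf z).trace = 0 →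
        (matOf z 0 1 = 0 ∨ matOf z 1 0 = 0) → (matOf z 0 0 = 0 ∨ matOf z 0 0 = 1) := by
      intro z hz hz'
      right
      have d := matOf_det z
      rw [Matrix.det_fin_two, mul_eq_zero.2 hz'] at d
      rw [Matrix.trace_fin_two, CharTwo.add_eq_zero] at hz
      apply sq_inj
      rw [← hz] at d
      linear_combination d
    have e1 : matOf x 0 1 = matOf x' 0 1 := by
      refine affine_aux (e := matOf x 0 0) (e' := matOf x' 0 0) h0 h1
        (fun hh => deg x hx (Or.inl hh)) (fun hh => deg x' hx' (Or.inl hh)) (fun u => ?_)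
      obtain ⟨y, y', H⟩ := exists_test_zero h0 h1 u
      rw [← (H x hx).1, ← (H x' hx').1, h]
    have e2 : matOf x 1 0 = matOf x' 1 0 := by
      refine affine_aux (e := matOf x 0 0) (e' := matOf x' 0 0) h0 h1
        (fun hh => deg x hx (Or.inr hh)) (fun hh => deg x' hx' (Or.inr hh)) (fun u => ?_)
      obtain ⟨y, y', H⟩ := exists_test_zero h0 h1 u
      rw [← (H x hx).2, ← (H x' hx').2, h]
    rw [e1, e2]
  · exact (sol_ne_aux h0 h1 hx hx' h).elim
  · exact (sol_ne_aux h0 h1 hx' hx h.symm).elim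
  · rw [if_neg hx, if_neg hx']
    have e1 : matOf x 0 1 / (matOf x).trace = matOf x' 0 1 / (matOf x').trace := by
      refine affine_aux (e := 0) (e' := 0) h0 h1 (by simp) (by simp) (fun u => ?_)
      obtain ⟨y, y', ty, ty', H⟩ := exists_test_ne u
      rw [← (H x hx).1, ← (H x' hx').1, h]
    have e2 : matOf x 1 0 / (matOf x).trace = matOf x' 1 0 / (matOf x').trace := by
      refine affine_aux (e := 0) (e' := 0) h0 h1 (by simp) (by simp) (fun u => ?_)
      obtain ⟨y, y', ty, ty', H⟩ := exists_test_ne u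
      rw [← (H x hx).2, ← (H x' hx').2, h]
    rw [e1, e2]

theorem solvSet_ncard_SL {ω : F} (h0 : ω ≠ 0) (h1 : ω ≠ 1) [Finite F] :
    (solvSet (SpecialLinearGroup (Fin 2) F)).ncard = 2 * (Nat.card F) ^ 2 := by
  have hsq : ∀ a : F, ∃ b, b ^ 2 = a :=
    Finite.surjective_of_injective (f := fun b : F => b ^ 2) (fun a b h => sq_inj h)
  have hs := invP_surjective h0 h1 hsq
  let g : (F × F) ⊕ (F × F) → Set (SpecialLinearGroup (Fin 2) F) :=
    fun t => solvabilizer (Function.surjInv hs t)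
  have hg : Function.Injective g := by
    intro t t' ht
    have := invP_of_sol_eq h0 h1 ht
    rwa [Function.surjInv_eq hs, Function.surjInv_eq hs] at this
  have hr : solvSet (SpecialLinearGroup (Fin 2) F) = g '' Set.univ := by
    rw [Set.image_univ]
    apply Set.Subset.antisymm
    · rintro _ ⟨x, rfl⟩
      exact ⟨invP x, sol_eq_of_invP (Function.surjInv_eq hs _)⟩
    · rintro _ ⟨t, rfl⟩
      exact ⟨_, rfl⟩
  rw [hr, Set.ncard_image_of_injective _ hg, Set.ncard_univ, Nat.card_sum, Nat.card_prod]
  ring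

theorem center_SL_eq_bot : Subgroup.center (SpecialLinearGroup (Fin 2) F) = ⊥ := by
  rw [eq_bot_iff]
  intro a ha
  rw [Matrix.SpecialLinearGroup.mem_center_iff] at ha
  obtain ⟨r, hr, hra⟩ := ha
  have : r = 1 := sq_inj (by simpa using hr)
  rw [Subgroup.mem_bot]
  apply matOf_inj
  change (a : Matrix (Fin 2) (Fin 2) F) = 1
  rw [← hra, this]
  simp

end Count

/-- For every integer `n ≥ 2`, `|Solv(PSL(2, 2^n))| = 2·(2^n)² = 2^(2n+1)`. -/
theorem solvSet_ncard_PSL_two_char_two (n : ℕ) (hn : 2 ≤ n) :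
    (solvSet (PSL 2 (GaloisField 2 n))).ncard = 2 * (2 ^ n) ^ 2 := by
  have hcard : Nat.card (GaloisField 2 n) = 2 ^ n := GaloisField.card 2 n (by omega)
  have hω : ∃ ω : GaloisField 2 n, ω ≠ 0 ∧ ω ≠ 1 := by
    by_contra hcon
    push Not at hcon
    have hsub : (Set.univ : Set (GaloisField 2 n)) ⊆ {0, 1} := by
      intro w _
      by_cases hw : w = 0
      · exact Or.inl hw
      · exact Or.inr (hcon w hw)
    have h1 := Set.ncard_le_ncard hsub (Set.toFinite _)
    have h2 := Set.ncard_pair (zero_ne_one (α := GaloisField 2 n))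
    rw [Set.ncard_univ, hcard] at h1
    have h3 : 2 ^ 2 ≤ 2 ^ n := Nat.pow_le_pow_right (by norm_num) hn
    omega
  obtain ⟨ω, h0, h1⟩ := hω
  have e : PSL 2 (GaloisField 2 n) ≃* Matrix.SpecialLinearGroup (Fin 2) (GaloisField 2 n) :=
    (QuotientGroup.quotientMulEquivOfEq center_SL_eq_bot).trans QuotientGroup.quotientBot
  rw [solvSet_ncard_congr e, solvSet_ncard_SL h0 h1, hcard]
end
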